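/- For 0 < α < 1, the modified Bessel function K_α satisfies ∫₀^∞ |K_α(r)|² r dr < ∞, and the map α ↦ ∫₀^∞ |K_α(r)|² r dr is positive with lim_{α→1⁻} (1−α)·∫₀^∞ |K_α(r)|² r dr > 0. -/

import Mathlib

open MeasureTheory Filter Topology

/-- The modified Bessel function of the second kind `K_α`, defined by the standard
integral representation `K_α(x) = ∫₀^∞ exp(−x cosh t) cosh(α t) dt`. -/
noncomputable def besselK (α x : ℝ) : ℝ :=
  ∫ t in Set.Ioi (0 : ℝ), Real.exp (-x * Real.cosh t) * Real.cosh (α * t)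

/-- `C_α = ∫₀^∞ K_α(r)² r dr`. -/
noncomputable def besselKsq (α : ℝ) : ℝ :=
  ∫ r in Set.Ioi (0 : ℝ), (besselK α r) ^ 2 * r

lemma bk_gamma_int {a c : ℝ} (ha : 0 < a) (hc : 0 < c) :
    IntegrableOn (fun u : ℝ => u ^ (a - 1) * Real.exp (-(c * u))) (Set.Ioi 0) := by
  have := integrableOn_rpow_mul_exp_neg_mul_rpow (p := 1) (s := a - 1) (b := c)
    (by linarith) one_pos hc
  simpa [neg_mul] using this

lemma bk_pos_of_pos {f : ℝ → ℝ} (hf : IntegrableOn f (Set.Ioi 0)) (h : ∀ x, 0 < x → 0 < f x) :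
    0 < ∫ x in Set.Ioi (0 : ℝ), f x := by
  rw [setIntegral_pos_iff_support_of_nonneg_ae _ hf]
  · have : Function.support f ∩ Set.Ioi 0 = Set.Ioi 0 := by
      apply Set.inter_eq_right.mpr
      intro x hx
      exact (h x hx).ne'
    rw [this]; simp
  · filter_upwards [ae_restrict_mem measurableSet_Ioi] with x hx
    exact (h x hx).le

/-- the integrand after substituting `u = exp t` -/
noncomputable def bkG (α r u : ℝ) : ℝ := u ^ (α - 1) * Real.exp (-(r / 2 * (u + u⁻¹)))

lemma bkG_pos (α r u : ℝ) (hu : 0 < u) : 0 < bkG α r u := by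
  unfold bkG; positivity

lemma bkG_le (α r u : ℝ) (hr : 0 < r) (hu : 0 < u) :
    bkG α r u ≤ u ^ (α - 1) * Real.exp (-(r / 2 * u)) := by
  unfold bkG
  gcongr
  have : 0 < u⁻¹ := by positivity
  linarith

lemma bkG_le' (α r u : ℝ) (hr : 0 < r) (hu : 0 < u) :
    bkG α r u ≤ Real.exp (-(r / 2)) * (u ^ (α - 1) * Real.exp (-(r / 4 * u))) := by
  have h2 : 2 ≤ u + u⁻¹ := by
    have : u + u⁻¹ - 2 = (u - 1) ^ 2 / u := by field_simp; ring
    have : 0 ≤ (u - 1) ^ 2 / u := by positivity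
    linarith
  have : 0 < u⁻¹ := by positivity
  unfold bkG
  rw [mul_left_comm, ← Real.exp_add]
  gcongr
  nlinarith

lemma bkG_ge (α r u : ℝ) (hr : 0 < r) (hu : 0 < u) :
    u ^ (α - 1) * Real.exp (-(r / 2 * u)) -
      (r / 2) ^ (1 / 2 : ℝ) * (u ^ (α - 1 / 2 - 1) * Real.exp (-(r / 2 * u))) ≤ bkG α r u := by
  have key : 1 - (r / 2 * u⁻¹) ^ (1 / 2 : ℝ) ≤ Real.exp (-(r / 2 * u⁻¹)) := by
    set x := r / 2 * u⁻¹ with hx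
    have hx0 : 0 < x := by positivity
    rcases le_total x 1 with h | h
    · have h1 := Real.add_one_le_exp (-x)
      have h2 : x ^ (1 : ℝ) ≤ x ^ (1 / 2 : ℝ) :=
        Real.rpow_le_rpow_of_exponent_ge hx0 h (by norm_num)
      rw [Real.rpow_one] at h2
      linarith
    · have h1 := Real.one_le_rpow h (by norm_num : (0 : ℝ) ≤ 1 / 2)
      have := Real.exp_pos (-x)
      linarith
  have e1 : u ^ (α - 1 / 2 - 1) = u ^ (α - 1) * (u⁻¹) ^ (1 / 2 : ℝ) := by
    rw [Real.inv_rpow hu.le, ← Real.rpow_neg hu.le, ← Real.rpow_add hu]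
    congr 1; ring
  have e2 : bkG α r u = u ^ (α - 1) * Real.exp (-(r / 2 * u)) * Real.exp (-(r / 2 * u⁻¹)) := by
    unfold bkG
    rw [mul_assoc, ← Real.exp_add]; congr 2; ring
  rw [e2, e1]
  rw [Real.mul_rpow (by positivity) (by positivity)] at key
  have hp : 0 ≤ u ^ (α - 1) * Real.exp (-(r / 2 * u)) := by positivity
  have := mul_le_mul_of_nonneg_left key hp
  linarith

lemma bkG_int {α r : ℝ} (hα : 0 < α) (hr : 0 < r) : IntegrableOn (bkG α r) (Set.Ioi 0) := by
  refine Integrable.mono' (bk_gamma_int hα (half_pos hr)) ?_ ?_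
  · refine Measurable.aestronglyMeasurable ?_
    unfold bkG; fun_prop
  · filter_upwards [ae_restrict_mem measurableSet_Ioi] with x hx
    rw [Real.norm_of_nonneg (bkG_pos α r x hx).le]
    exact bkG_le α r x hr hx

lemma besselK_eq {α r : ℝ} (hα : 0 < α) (hr : 0 < r) :
    besselK α r = 1 / 2 * ∫ u in Set.Ioi (0 : ℝ), bkG α r u := by
  have him : Real.exp '' Set.univ = Set.Ioi 0 := by rw [Set.image_univ, Real.range_exp]
  have hd : ∀ x ∈ (Set.univ : Set ℝ), HasDerivWithinAt Real.exp (Real.exp x) Set.univ x :=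
    fun x _ => (Real.hasDerivAt_exp x).hasDerivWithinAt
  have hfun : (fun t : ℝ => |Real.exp t| • bkG α r (Real.exp t)) =
      fun t => Real.exp (-r * Real.cosh t) * Real.exp (α * t) := by
    funext t
    unfold bkG
    rw [abs_of_pos (Real.exp_pos t), smul_eq_mul, ← Real.exp_mul, ← Real.exp_neg,
      ← Real.exp_add, ← Real.exp_add, ← Real.exp_add, Real.cosh_eq]
    congr 1; ring
  have hInt := (integrableOn_image_iff_integrableOn_abs_deriv_smul MeasurableSet.univ hd
    Real.exp_injective.injOn (bkG α r)).mp (by rw [him]; exact bkG_int hα hr)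
  have heq := integral_image_eq_integral_abs_deriv_smul MeasurableSet.univ hd
    Real.exp_injective.injOn (bkG α r)
  rw [him] at heq
  rw [hfun] at hInt heq
  rw [integrableOn_univ] at hInt
  rw [heq, setIntegral_univ]
  set h : ℝ → ℝ := fun t => Real.exp (-r * Real.cosh t) * Real.exp (α * t) with hh
  have hneg : Integrable (fun t => h (-t)) := hInt.comp_neg
  rw [← intervalIntegral.integral_Iic_add_Ioi (b := (0 : ℝ)) hInt.integrableOn hInt.integrableOn]
  have e := integral_comp_neg_Ioi 0 h
  rw [neg_zero] at e
  rw [← e, ← integral_add hneg.integrableOn hInt.integrableOn, ← integral_const_mul]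
  unfold besselK
  congr 1
  funext t
  simp only [hh, Real.cosh_neg]
  rw [Real.cosh_eq (α * t)]
  rw [show α * -t = -(α * t) by ring]
  ring

lemma besselK_pos {α r : ℝ} (hα : 0 < α) (hr : 0 < r) : 0 < besselK α r := by
  rw [besselK_eq hα hr]
  have := bk_pos_of_pos (bkG_int hα hr) (fun x hx => bkG_pos α r x hx)
  linarith

lemma besselK_le {α r : ℝ} (hα : 0 < α) (hr : 0 < r) :
    besselK α r ≤ 1 / 2 * ((2 / r) ^ α * Real.Gamma α) := by
  rw [besselK_eq hα hr]
  have := setIntegral_mono_on (bkG_int hα hr) (bk_gamma_int hα (half_pos hr)) measurableSet_Ioi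
    (fun x hx => bkG_le α r x hr hx)
  rw [Real.integral_rpow_mul_exp_neg_mul_Ioi hα (half_pos hr), one_div_div] at this
  linarith

lemma besselK_le' {α r : ℝ} (hα : 0 < α) (hr : 0 < r) :
    besselK α r ≤ 1 / 2 * (Real.exp (-(r / 2)) * ((4 / r) ^ α * Real.Gamma α)) := by
  rw [besselK_eq hα hr]
  have h4 : 0 < r / 4 := by positivity
  have := setIntegral_mono_on (bkG_int hα hr)
    ((bk_gamma_int hα h4).const_mul (Real.exp (-(r / 2)))) measurableSet_Ioi
    (fun x hx => bkG_le' α r x hr hx)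
  rw [integral_const_mul, Real.integral_rpow_mul_exp_neg_mul_Ioi hα h4, one_div_div] at this
  linarith

lemma besselK_ge {α r : ℝ} (hα : 1 / 2 < α) (hr : 0 < r) :
    1 / 2 * ((2 / r) ^ α * Real.Gamma α) -
      1 / 2 * ((r / 2) ^ (1 / 2 : ℝ) * ((2 / r) ^ (α - 1 / 2) * Real.Gamma (α - 1 / 2)))
      ≤ besselK α r := by
  have hα0 : 0 < α := by linarith
  have hα1 : 0 < α - 1 / 2 := by linarith
  rw [besselK_eq hα0 hr]
  have i1 := bk_gamma_int hα0 (half_pos hr)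
  have i2 := (bk_gamma_int hα1 (half_pos hr)).const_mul ((r / 2) ^ (1 / 2 : ℝ))
  have := setIntegral_mono_on (i1.sub i2) (bkG_int hα0 hr) measurableSet_Ioi
    (fun x hx => bkG_ge α r x hr hx)
  simp only [Pi.sub_apply] at this
  rw [integral_sub i1 i2, integral_const_mul,
    Real.integral_rpow_mul_exp_neg_mul_Ioi hα0 (half_pos hr),
    Real.integral_rpow_mul_exp_neg_mul_Ioi hα1 (half_pos hr), one_div_div] at this
  linarith

lemma besselK_meas (α : ℝ) : StronglyMeasurable (besselK α) := by
  unfold besselK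
  apply StronglyMeasurable.integral_prod_right
    (f := fun x t : ℝ => Real.exp (-x * Real.cosh t) * Real.cosh (α * t))
  apply Continuous.stronglyMeasurable
  fun_prop

lemma bk_pow {k r α : ℝ} (hk : 0 < k) (hr : 0 < r) :
    ((k / r) ^ α) ^ 2 * r = (k ^ 2) ^ α * r ^ (1 - 2 * α) := by
  rw [Real.div_rpow hk.le hr.le, div_pow, ← Real.rpow_natCast (r ^ α), ← Real.rpow_mul hr.le,
    ← Real.rpow_natCast (k ^ α), ← Real.rpow_mul hk.le, ← Real.rpow_natCast k,
    ← Real.rpow_mul hk.le, Real.rpow_sub hr, Real.rpow_one]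
  push_cast
  rw [mul_comm α 2]
  ring

/-- tail bound -/
lemma besselK_sq_le' {α r : ℝ} (hα : 0 < α) (hr : 0 < r) :
    besselK α r ^ 2 * r ≤
      1 / 4 * Real.Gamma α ^ 2 * (4 ^ 2) ^ α * (r ^ (1 - 2 * α) * Real.exp (-r)) := by
  have h := pow_le_pow_left₀ (besselK_pos hα hr).le (besselK_le' hα hr) 2
  have h' := mul_le_mul_of_nonneg_right h hr.le
  refine h'.trans (le_of_eq ?_)
  have e := bk_pow (α := α) (by norm_num : (0 : ℝ) < 4) hr
  have e2 : Real.exp (-(r / 2)) ^ 2 = Real.exp (-r) := by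
    rw [← Real.exp_nat_mul]; congr 1; push_cast; ring
  rw [← e2]
  linear_combination (1 / 4 * Real.exp (-(r / 2)) ^ 2 * Real.Gamma α ^ 2) * e

lemma besselK_sq_le {α r : ℝ} (hα : 0 < α) (hr : 0 < r) :
    besselK α r ^ 2 * r ≤
      1 / 4 * Real.Gamma α ^ 2 * (2 ^ 2) ^ α * r ^ (1 - 2 * α) := by
  have h := pow_le_pow_left₀ (besselK_pos hα hr).le (besselK_le hα hr) 2
  have h' := mul_le_mul_of_nonneg_right h hr.le
  refine h'.trans (le_of_eq ?_)
  have e := bk_pow (α := α) (by norm_num : (0 : ℝ) < 2) hr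
  linear_combination (1 / 4 * Real.Gamma α ^ 2) * e

lemma besselK_sq_ge {α r : ℝ} (hα : 1 / 2 < α) (hα1 : α < 1) (hr : 0 < r) (hr1 : r ≤ 1) :
    1 / 4 * Real.Gamma α ^ 2 * (2 ^ 2) ^ α * r ^ (1 - 2 * α) -
      Real.Gamma α * Real.Gamma (α - 1 / 2) ≤ besselK α r ^ 2 * r := by
  have e := bk_pow (α := α) (by norm_num : (0 : ℝ) < 2) hr
  have h := besselK_ge hα hr
  have hK := besselK_pos (by linarith : 0 < α) hr
  have hg : 0 < Real.Gamma α := Real.Gamma_pos_of_pos (by linarith)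
  have hg' : 0 < Real.Gamma (α - 1 / 2) := Real.Gamma_pos_of_pos (by linarith)
  have hP : (0 : ℝ) < 2 / r := by positivity
  have hX : (r / 2) ^ (1 / 2 : ℝ) * ((2 / r) ^ (α - 1 / 2)) = (2 / r) ^ (α - 1) := by
    rw [← inv_div 2 r, Real.inv_rpow hP.le, ← Real.rpow_neg hP.le, ← Real.rpow_add hP]
    congr 1; ring
  have hY : (2 / r) ^ α * (2 / r) ^ (α - 1) ≤ 2 / r := by
    rw [← Real.rpow_add hP]
    calc (2 / r) ^ (α + (α - 1)) ≤ (2 / r) ^ (1 : ℝ) := by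
          apply Real.rpow_le_rpow_of_exponent_le
          · rw [le_div_iff₀ hr]; linarith
          · linarith
      _ = 2 / r := Real.rpow_one _
  have hY' : (2 / r) ^ α * (2 / r) ^ (α - 1) * r ≤ 2 := by
    calc _ ≤ 2 / r * r := by gcongr
      _ = 2 := by field_simp
  rw [← mul_assoc ((r / 2) ^ (1 / 2 : ℝ)), hX] at h
  set P := (2 / r) ^ α
  set Q := (2 / r) ^ (α - 1)
  have hP0 : 0 < P := by positivity
  have hQ0 : 0 < Q := by positivity
  set A := 1 / 2 * (P * Real.Gamma α)
  set B := 1 / 2 * (Q * Real.Gamma (α - 1 / 2))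
  have hA : 0 < A := by positivity
  have hB : 0 < B := by positivity
  have hsq : A ^ 2 - 2 * A * B ≤ besselK α r ^ 2 := by
    rcases le_total A B with hab | hab
    · nlinarith [sq_nonneg (besselK α r), mul_pos hA hB]
    · nlinarith [sq_nonneg B, pow_le_pow_left₀ (sub_nonneg.mpr hab) h 2]
  have h1 := mul_le_mul_of_nonneg_right hsq hr.le
  have h2 := mul_le_mul_of_nonneg_left hY' (mul_pos hg hg').le
  have e1 : A ^ 2 * r = 1 / 4 * Real.Gamma α ^ 2 * (2 ^ 2) ^ α * r ^ (1 - 2 * α) := by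
    simp only [A]; linear_combination (1 / 4 * Real.Gamma α ^ 2) * e
  have e2 : 2 * A * B * r =
      1 / 2 * (Real.Gamma α * Real.Gamma (α - 1 / 2) * (P * Q * r)) := by
    simp only [A, B]; ring
  linarith

lemma besselK_sq_int {α : ℝ} (hα : 0 < α) (hα1 : α < 1) :
    IntegrableOn (fun r : ℝ => (besselK α r) ^ 2 * r) (Set.Ioi 0) := by
  have h := bk_gamma_int (a := 2 - 2 * α) (c := 1) (by linarith) one_pos
  refine Integrable.mono' (h.const_mul (1 / 4 * Real.Gamma α ^ 2 * (4 ^ 2) ^ α)) ?_ ?_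
  · exact (((besselK_meas α).pow 2).mul stronglyMeasurable_id).aestronglyMeasurable
  · filter_upwards [ae_restrict_mem measurableSet_Ioi] with r hr
    have hr : 0 < r := hr
    rw [Real.norm_of_nonneg (by positivity)]
    have := besselK_sq_le' hα hr
    rwa [one_mul, show 2 - 2 * α - 1 = 1 - 2 * α by ring]

lemma bk_rpow_int {α : ℝ} (hα1 : α < 1) :
    IntegrableOn (fun r : ℝ => r ^ (1 - 2 * α)) (Set.Ioc 0 1) ∧
    ∫ r in Set.Ioc (0 : ℝ) 1, r ^ (1 - 2 * α) = 1 / (2 * (1 - α)) := by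
  have h : -1 < 1 - 2 * α := by linarith
  constructor
  · exact (intervalIntegrable_iff_integrableOn_Ioc_of_le zero_le_one).mp
      (intervalIntegral.intervalIntegrable_rpow' h)
  · rw [← intervalIntegral.integral_of_le zero_le_one, integral_rpow (Or.inl h),
      Real.one_rpow, Real.zero_rpow (by linarith)]
    congr 1 <;> ring

lemma besselKsq_split {α : ℝ} (hα : 0 < α) (hα1 : α < 1) :
    besselKsq α = (∫ r in Set.Ioc (0 : ℝ) 1, besselK α r ^ 2 * r) +
      ∫ r in Set.Ioi (1 : ℝ), besselK α r ^ 2 * r := by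
  have h := besselK_sq_int hα hα1
  unfold besselKsq
  rw [← Set.Ioc_union_Ioi_eq_Ioi (zero_le_one (α := ℝ))] at h ⊢
  exact setIntegral_union Set.Ioc_disjoint_Ioi_same measurableSet_Ioi
    (h.mono_set Set.subset_union_left) (h.mono_set Set.subset_union_right)

lemma besselKsq_upper {α : ℝ} (hα : 1 / 2 < α) (hα1 : α < 1) :
    (1 - α) * besselKsq α ≤ 1 / 8 * Real.Gamma α ^ 2 * (2 ^ 2) ^ α +
      (1 - α) * (1 / 4 * Real.Gamma α ^ 2 * (4 ^ 2) ^ α) := by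
  have hα0 : 0 < α := by linarith
  have h := besselK_sq_int hα0 hα1
  obtain ⟨ri, re⟩ := bk_rpow_int hα1
  have h1 := setIntegral_mono_on (h.mono_set Set.Ioc_subset_Ioi_self)
    (ri.const_mul (1 / 4 * Real.Gamma α ^ 2 * (2 ^ 2) ^ α)) measurableSet_Ioc
    (fun r hr => besselK_sq_le hα0 hr.1)
  have h2 := setIntegral_mono_on (h.mono_set (Set.Ioi_subset_Ioi zero_le_one))
    ((integrableOn_exp_neg_Ioi 1).const_mul (1 / 4 * Real.Gamma α ^ 2 * (4 ^ 2) ^ α))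
    measurableSet_Ioi
    (fun r (hr : 1 < r) => (besselK_sq_le' hα0 (by linarith)).trans (by
      apply mul_le_mul_of_nonneg_left _ (by positivity)
      have := Real.rpow_le_one_of_one_le_of_nonpos hr.le (by linarith : 1 - 2 * α ≤ 0)
      nlinarith [Real.exp_pos (-r)]))
  rw [integral_const_mul, re] at h1
  rw [integral_const_mul, integral_exp_neg_Ioi] at h2
  have h3 : 1 / 4 * Real.Gamma α ^ 2 * (4 ^ 2) ^ α * Real.exp (-1) ≤
      1 / 4 * Real.Gamma α ^ 2 * (4 ^ 2) ^ α :=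
    mul_le_of_le_one_right (by positivity) (by rw [Real.exp_le_one_iff]; norm_num)
  rw [besselKsq_split hα0 hα1]
  have hp : 0 < 1 - α := by linarith
  calc _ ≤ (1 - α) * (1 / 4 * Real.Gamma α ^ 2 * (2 ^ 2) ^ α * (1 / (2 * (1 - α))) +
        1 / 4 * Real.Gamma α ^ 2 * (4 ^ 2) ^ α) := by
        apply mul_le_mul_of_nonneg_left _ hp.le
        linarith
    _ = _ := by field_simp; ring

lemma besselKsq_lower {α : ℝ} (hα : 1 / 2 < α) (hα1 : α < 1) :
    1 / 8 * Real.Gamma α ^ 2 * (2 ^ 2) ^ α -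
      (1 - α) * (Real.Gamma α * Real.Gamma (α - 1 / 2)) ≤ (1 - α) * besselKsq α := by
  have hα0 : 0 < α := by linarith
  have h := besselK_sq_int hα0 hα1
  obtain ⟨ri, re⟩ := bk_rpow_int hα1
  have i1 := ri.const_mul (1 / 4 * Real.Gamma α ^ 2 * (2 ^ 2) ^ α)
  have i2 : IntegrableOn (fun _ : ℝ => Real.Gamma α * Real.Gamma (α - 1 / 2)) (Set.Ioc 0 1) :=
    integrableOn_const (by simp)
  have h1 := setIntegral_mono_on (i1.sub i2) (h.mono_set Set.Ioc_subset_Ioi_self)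
    measurableSet_Ioc (fun r hr => besselK_sq_ge hα hα1 hr.1 hr.2)
  have h2 : 0 ≤ ∫ r in Set.Ioi (1 : ℝ), besselK α r ^ 2 * r :=
    setIntegral_nonneg measurableSet_Ioi (fun r (hr : 1 < r) => by
      have : 0 < r := by linarith
      positivity)
  simp only [Pi.sub_apply] at h1
  rw [integral_sub i1 i2, integral_const_mul, re] at h1
  simp only [integral_const, MeasurableSet.univ, measureReal_restrict_apply, Set.univ_inter,
    Real.volume_real_Ioc, smul_eq_mul] at h1
  norm_num at h1
  rw [besselKsq_split hα0 hα1]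
  have hp : 0 < 1 - α := by linarith
  calc _ = (1 - α) * (1 / 4 * Real.Gamma α ^ 2 * (2 ^ 2) ^ α * (1 / (2 * (1 - α))) -
        Real.Gamma α * Real.Gamma (α - 1 / 2)) := by field_simp; ring
    _ ≤ _ := by
        apply mul_le_mul_of_nonneg_left _ hp.le
        norm_num
        linarith

/-- For `0 < α < 1`, the function `r ↦ K_α(r)² r` is integrable on `(0,∞)`, the integral
`C_α` is positive, and `(1−α)·C_α` has a positive limit as `α → 1⁻`. -/
theorem besselK_square_integrable_and_limit :
    (∀ α : ℝ, 0 < α → α < 1 →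
      IntegrableOn (fun r : ℝ => (besselK α r) ^ 2 * r) (Set.Ioi 0) ∧ 0 < besselKsq α) ∧
    (∃ L : ℝ, 0 < L ∧
      Tendsto (fun α : ℝ => (1 - α) * besselKsq α) (nhdsWithin 1 (Set.Iio 1)) (nhds L)) := by
  refine ⟨fun α h0 h1 => ⟨besselK_sq_int h0 h1, ?_⟩, 1 / 2, by norm_num, ?_⟩
  · exact bk_pos_of_pos (besselK_sq_int h0 h1) (fun r hr => by
      have := besselK_pos h0 hr
      positivity)
  have hG : ContinuousAt Real.Gamma 1 := (Real.differentiableAt_Gamma (fun m => by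
    have : (0 : ℝ) ≤ m := m.cast_nonneg
    linarith)).continuousAt
  have hG' : ContinuousAt (fun α : ℝ => Real.Gamma (α - 1 / 2)) 1 := by
    apply ContinuousAt.comp (g := Real.Gamma) (f := fun α : ℝ => α - 1 / 2)
    · exact (Real.differentiableAt_Gamma (fun m => by
        have : (0 : ℝ) ≤ m := m.cast_nonneg
        linarith)).continuousAt
    · fun_prop
  have hpow : ∀ c : ℝ, 0 < c → ContinuousAt (fun α : ℝ => c ^ α) 1 := fun c hc =>
    (Real.continuous_const_rpow hc.ne').continuousAt
  have hid : ContinuousAt (fun α : ℝ => 1 - α) 1 := by fun_prop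
  have hlow : ContinuousAt (fun α : ℝ => 1 / 8 * Real.Gamma α ^ 2 * (2 ^ 2) ^ α -
      (1 - α) * (Real.Gamma α * Real.Gamma (α - 1 / 2))) 1 :=
    ((continuousAt_const.mul (hG.pow 2)).mul (hpow _ (by norm_num))).sub (hid.mul (hG.mul hG'))
  have hup : ContinuousAt (fun α : ℝ => 1 / 8 * Real.Gamma α ^ 2 * (2 ^ 2) ^ α +
      (1 - α) * (1 / 4 * Real.Gamma α ^ 2 * (4 ^ 2) ^ α)) 1 :=
    ((continuousAt_const.mul (hG.pow 2)).mul (hpow _ (by norm_num))).add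
      (hid.mul ((continuousAt_const.mul (hG.pow 2)).mul (hpow _ (by norm_num))))
  have tlow := hlow.tendsto.mono_left (nhdsWithin_le_nhds (s := Set.Iio 1))
  have tup := hup.tendsto.mono_left (nhdsWithin_le_nhds (s := Set.Iio 1))
  norm_num [Real.Gamma_one] at tlow tup
  have hev : ∀ᶠ α : ℝ in nhdsWithin 1 (Set.Iio 1), 1 / 2 < α ∧ α < 1 := by
    filter_upwards [self_mem_nhdsWithin,
      nhdsWithin_le_nhds (lt_mem_nhds (by norm_num : (1 / 2 : ℝ) < 1))] with α h1 h2
    exact ⟨h2, h1⟩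
  norm_num
  refine tendsto_of_tendsto_of_tendsto_of_le_of_le' tlow tup ?_ ?_
  · filter_upwards [hev] with α hα
    have := besselKsq_lower hα.1 hα.2
    norm_num at this ⊢
    linarith
  · filter_upwards [hev] with α hα
    have := besselKsq_upper hα.1 hα.2
    norm_num at this ⊢
    linarith
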